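/- arXiv:0707.0718 — 3 statements merged into one kernel-verified Lean document; each statement's English description precedes it below -/
import Mathlib

section
/- Let p be an odd prime, q = p^α with α ≥ 1, and a an integer coprime to p; let L_q(a) := (ℤ/q, x ↦ a·x²/q mod ℤ). Define W₁ ⊆ ℂ[ℤ/q] as follows: if α = 1, W₁ is all of ℂ[ℤ/q]; if α ≥ 2, W₁ := {λ : Σ_{t mod p} λ(x + p^{α−1}·t) = 0 for all x ∈ p·(ℤ/q)}. For ε ∈ {+1,−1} set W₁^ε := {λ ∈ W₁ : λ(−x) = ε·λ(x) for all x}. Let ρ : SL₂(ℤ) → GL(ℂ[ℤ/q]) be a group homomorphism with ρ(T) = T_{L_q(a)} and ρ(S) = S_{L_q(a)}, where T = [1,1;0,1] and S = [0,−1;1,0]. Then for each ε ∈ {+1,−1} the subspace W₁^ε is nonzero, is invariant under ρ(A) for every A ∈ SL₂(ℤ), and is irreducible: its only ρ-invariant subspaces are 0 and W₁^ε itself. -/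
noncomputable section

/-- `ℚ/ℤ` as the additive circle of circumference 1. -/
abbrev QZ : Type := AddCircle (1 : ℚ)

lemma expPeriodic : Function.Periodic
    (fun q : ℚ => Complex.exp (2 * Real.pi * Complex.I * (q : ℂ))) 1 := by
  intro x
  push_cast
  rw [mul_add, Complex.exp_add, mul_one, Complex.exp_two_pi_mul_I, mul_one]

/-- The standard character `e : ℚ/ℤ → ℂ`, `e(t) = exp(2πi t)`. -/
def ee : QZ → ℂ := expPeriodic.lift

variable {M : Type} [AddCommGroup M]

/-- The bilinear form associated to a quadratic form `Q : M → ℚ/ℤ`. -/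
def Bf (Q : M → QZ) (x y : M) : QZ := Q (x + y) - Q x - Q y

/-- The Gauss sum `σ(M) = |M|^{-1/2} ∑_{x ∈ M} e(-Q(x))`. -/
def gaussSigma (Q : M → QZ) : ℂ :=
  ((Real.sqrt (Nat.card M) : ℂ))⁻¹ * ∑ᶠ x : M, ee (-(Q x))

/-- The operator `T_M` of the Weil representation: `(T_M λ)(x) = e(Q(x))·λ(x)`. -/
def Tweil (Q : M → QZ) (lam : M → ℂ) : M → ℂ := fun x => ee (Q x) * lam x

/-- The operator `S_M` of the Weil representation:
`(S_M λ)(y) = σ(M)·|M|^{-1/2}·∑_{x∈M} e(-B(y,x))·λ(x)`. -/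
def Sweil (Q : M → QZ) (lam : M → ℂ) : M → ℂ := fun y =>
  gaussSigma Q * ((Real.sqrt (Nat.card M) : ℂ))⁻¹ *
    ∑ᶠ x : M, ee (-(Bf Q y x)) * lam x

/-- The `p`-primary component of an abelian group, as a subgroup. -/
def primaryComp (M : Type) [AddCommGroup M] (p : ℕ) : AddSubgroup M where
  carrier := {x | ∃ k : ℕ, (p ^ k : ℕ) • x = 0}
  zero_mem' := ⟨0, smul_zero _⟩
  add_mem' := by
    rintro a b ⟨k, hk⟩ ⟨l, hl⟩
    refine ⟨k + l, ?_⟩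
    have ha : (p ^ (k + l) : ℕ) • a = 0 := by
      rw [pow_add, mul_comm, mul_smul, hk, smul_zero]
    have hb : (p ^ (k + l) : ℕ) • b = 0 := by
      rw [pow_add, mul_smul, hl, smul_zero]
    rw [smul_add, ha, hb, add_zero]
  neg_mem' := by
    rintro a ⟨k, hk⟩
    exact ⟨k, by rw [smul_neg, hk, neg_zero]⟩

end

open ZMod in
lemma aux_shift {N : ℕ} [NeZero N] (P : ZMod N) (hP : ∀ y : ZMod N, ¬ IsUnit y → y * P = 0)
    (v : ZMod N → ℂ) (hF : ∀ y, IsUnit y → dft v y = 0) (x t : ZMod N) : v (x + P * t) = v x := by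
  have h : dft (fun x => v (x + P * t)) = dft v := by
    ext y
    have h1 : dft (fun x => v (x + P * t)) y = stdAddChar (P * t * y) * dft v y := by
      simp only [dft_apply, smul_eq_mul, Finset.mul_sum]
      refine Fintype.sum_equiv (Equiv.addRight (P * t)) _ _ fun j => ?_
      simp only [Equiv.coe_addRight]
      rw [← mul_assoc, ← AddChar.map_add_eq_mul]
      congr 2
      ring
    rw [h1]
    by_cases hy : IsUnit y
    · rw [hF y hy, mul_zero]
    · have : P * t * y = 0 := by
        rw [mul_right_comm, mul_comm P y, hP y hy, zero_mul]
      rw [this, AddChar.map_zero_eq_one, one_mul]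
  exact congrFun (dft.injective h) x

lemma aux_orth {ι : Type} [Fintype ι] (W : Submodule ℂ (ι → ℂ)) (l : ι → ℂ) :
    ∃ w ∈ W, ∃ v : ι → ℂ, l = w + v ∧ ∀ w' ∈ W, ∑ i, star (w' i) * v i = 0 := by
  let E := (WithLp.linearEquiv 2 ℂ (ι → ℂ))
  let K : Submodule ℂ (EuclideanSpace ℂ ι) := W.map E.symm.toLinearMap
  obtain ⟨y, hy, z, hz, h⟩ := K.exists_add_mem_mem_orthogonal (E.symm l)
  obtain ⟨w, hw, rfl⟩ := hy
  refine ⟨w, hw, E z, ?_, ?_⟩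
  · have := congrArg E h
    simpa using this
  · intro w' hw'
    have := hz (E.symm w') ⟨w', hw', rfl⟩
    rw [PiLp.inner_apply] at this
    rw [← this]
    refine Finset.sum_congr rfl fun i _ => ?_
    simp [E, mul_comm]

/-- symmetrised delta function -/
noncomputable def eDel {N : ℕ} (ε : ℂ) (x : ZMod N) : ZMod N → ℂ :=
  Pi.single x 1 + ε • Pi.single (-x) 1

open ZMod in
lemma aux_proj {N : ℕ} [NeZero N] (a : ZMod N) (ha : IsUnit a) (ε : ℂ)
    (hne : ∀ x : ZMod N, IsUnit x → x ≠ -x)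
    (hsq : ∀ x z : ZMod N, IsUnit x → z ^ 2 = x ^ 2 → z = x ∨ z = -x)
    (W : Submodule ℂ (ZMod N → ℂ))
    (hT : ∀ l ∈ W, (fun x => stdAddChar (a * x ^ 2) * l x) ∈ W)
    (l : ZMod N → ℂ) (hl : l ∈ W) (hle : ∀ x, l (-x) = ε * l x)
    (x : ZMod N) (hx : IsUnit x) (hlx : l x ≠ 0) : eDel ε x ∈ W := by
  have hTk : ∀ k : ℕ, (fun z => stdAddChar (a * z ^ 2) ^ k * l z) ∈ W := by
    intro k
    induction k with
    | zero => simpa using hl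
    | succ k ih =>
      have := hT _ ih
      convert this using 2 with z
      ring
  have hsum : (∑ k : ZMod N, stdAddChar (-(k * (a * x ^ 2))) •
      (fun z => stdAddChar (a * z ^ 2) ^ k.val * l z)) ∈ W :=
    W.sum_mem fun k _ => W.smul_mem _ (hTk _)
  have heq : (∑ k : ZMod N, stdAddChar (-(k * (a * x ^ 2))) •
      (fun z => stdAddChar (a * z ^ 2) ^ k.val * l z)) = ((N : ℂ) * l x) • eDel ε x := by
    ext z
    rw [Finset.sum_apply]
    have h1 : ∀ k : ZMod N, (stdAddChar (-(k * (a * x ^ 2))) •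
      (fun z => stdAddChar (a * z ^ 2) ^ k.val * l z)) z
        = stdAddChar (k * (a * z ^ 2 - a * x ^ 2)) * l z := by
      intro k
      simp only [Pi.smul_apply, smul_eq_mul]
      rw [← AddChar.map_nsmul_eq_pow, ← mul_assoc, ← AddChar.map_add_eq_mul, nsmul_eq_mul,
        ZMod.natCast_zmod_val]
      congr 2
      ring
    simp only [h1]
    rw [← Finset.sum_mul, AddChar.sum_mulShift _ (isPrimitive_stdAddChar N), ZMod.card]
    simp only [eDel, Pi.smul_apply, Pi.add_apply, smul_eq_mul]
    have hx' := hne x hx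
    by_cases hz : z = x
    · subst hz
      simp [hx']
    by_cases hz' : z = -x
    · subst hz'
      simp [hx'.symm, hle]
      ring
    have : ¬ (a * z ^ 2 - a * x ^ 2 = 0) := by
      intro h
      rw [← mul_sub] at h
      have h2 := (ha.mul_right_eq_zero).1 h
      rcases hsq x z hx (sub_eq_zero.1 h2) with h | h
      · exact hz h
      · exact hz' h
    simp [this, hz, hz']
  rw [heq] at hsum
  have hc : ((N : ℂ) * l x) ≠ 0 := mul_ne_zero (NeZero.ne _) hlx
  exact (W.smul_mem_iff hc).1 hsum

open ZMod in
lemma aux_dft_eDel {N : ℕ} [NeZero N] (ε : ℂ) (x k : ZMod N) :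
    dft (eDel ε x) k = stdAddChar (-(x * k)) + ε * stdAddChar (x * k) := by
  rw [dft_apply]
  simp only [eDel, Pi.add_apply, Pi.smul_apply, smul_eq_mul, mul_add, Finset.sum_add_distrib,
    Pi.single_apply]
  simp [mul_comm]

open ZMod in
lemma aux_dft_neg {N : ℕ} [NeZero N] (ε : ℂ) (v : ZMod N → ℂ) (hv : ∀ x, v (-x) = ε * v x)
    (k : ZMod N) : dft v (-k) = ε * dft v k := by
  have h := congrFun (dft_comp_neg v) k
  rw [← h]
  simp only [hv]
  rw [dft_const_mul]

open ZMod in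
lemma aux_ne {N : ℕ} [NeZero N] (hN : Odd N) (hN1 : N ≠ 1) (h2 : IsUnit (2 : ZMod N))
    (ε : ℂ) (hε : ε = 1 ∨ ε = -1)
    (k : ZMod N) (hk : IsUnit k) : (stdAddChar (-k) + ε * stdAddChar k : ℂ) ≠ 0 := by
  intro h
  have : Fact (1 < N) := ⟨by have := NeZero.ne N; omega⟩
  have h3 : (1 : ℂ) + ε * stdAddChar (k + k) = 0 := by
    have : (stdAddChar k : ℂ) * (stdAddChar (-k) + ε * stdAddChar k) = 0 := by rw [h, mul_zero]
    rw [mul_add, ← AddChar.map_add_eq_mul, add_neg_cancel, AddChar.map_zero_eq_one] at this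
    rw [AddChar.map_add_eq_mul, ← this]
    ring
  have hpow : (stdAddChar (k + k) : ℂ) ^ N = 1 := by
    rw [← AddChar.map_nsmul_eq_pow, nsmul_eq_mul, ZMod.natCast_self, zero_mul,
      AddChar.map_zero_eq_one]
  rcases hε with rfl | rfl
  · have : (stdAddChar (k + k) : ℂ) = -1 := by linear_combination h3
    rw [this, hN.neg_one_pow] at hpow
    norm_num at hpow
  · have : (stdAddChar (k + k) : ℂ) = stdAddChar (0 : ZMod N) := by
      rw [AddChar.map_zero_eq_one]; linear_combination -h3
    have h4 := injective_stdAddChar this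
    rw [← two_mul] at h4
    exact (h2.mul hk).ne_zero h4

open ZMod in
lemma aux_irred {N : ℕ} [NeZero N] (hN : Odd N) (hN1 : N ≠ 1) (h2 : IsUnit (2 : ZMod N))
    (a b : ZMod N) (ha : IsUnit a) (hb : IsUnit b) (ε : ℂ) (hε : ε = 1 ∨ ε = -1)
    (hsq : ∀ x z : ZMod N, IsUnit x → z ^ 2 = x ^ 2 → z = x ∨ z = -x)
    (P : ZMod N) (hP : ∀ y : ZMod N, ¬ IsUnit y → y * P = 0)
    (V W : Submodule ℂ (ZMod N → ℂ)) (hWV : W ≤ V)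
    (hVe : ∀ l ∈ V, ∀ x, l (-x) = ε * l x)
    (hVnew : ∀ l ∈ V, (∀ x, IsUnit x → l x = 0) → (∀ x t, l (x + P * t) = l x) → l = 0)
    (hT : ∀ l ∈ W, (fun x => stdAddChar (a * x ^ 2) * l x) ∈ W)
    (hS : ∀ l ∈ W, (fun x => dft l (b * x)) ∈ W) : W = ⊥ ∨ W = V := by
  have : Fact (1 < N) := ⟨by have := NeZero.ne N; omega⟩
  have hne : ∀ x : ZMod N, IsUnit x → x ≠ -x := by
    intro x hx h
    have : 2 * x = 0 := by rw [two_mul]; nth_rewrite 2 [h]; ring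
    exact (h2.mul hx).ne_zero this
  have hεε : ε * ε = 1 := by rcases hε with rfl | rfl <;> norm_num
  have hεs : star ε = ε := by rcases hε with rfl | rfl <;> simp
  obtain ⟨b', hb'⟩ := hb.exists_right_inv
  have hub' : IsUnit b' := .of_mul_eq_one b (by rw [mul_comm, hb'])
  by_cases h0 : ∀ l ∈ W, ∀ x, IsUnit x → l x = 0
  · left
    rw [eq_bot_iff]
    intro l hl
    rw [Submodule.mem_bot]
    refine hVnew l (hWV hl) (h0 l hl) (aux_shift P hP l fun y hy => ?_)
    have := h0 _ (hS l hl) (b' * y) (hub'.mul hy)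
    simpa [← mul_assoc, hb'] using this
  right
  push Not at h0
  obtain ⟨l0, hl0, x0, hx0, hne0⟩ := h0
  have hp := aux_proj a ha ε hne hsq W hT
  have he0 := hp l0 hl0 (hVe _ (hWV hl0)) x0 hx0 hne0
  have hall : ∀ y, IsUnit y → eDel ε y ∈ W := by
    intro y hy
    have h1 := hS _ he0
    refine hp _ h1 (hVe _ (hWV h1)) y hy ?_
    simp only [aux_dft_eDel]
    exact aux_ne hN hN1 h2 ε hε _ (hx0.mul (hb.mul hy))
  refine le_antisymm hWV fun l hl => ?_
  obtain ⟨w, hw, v, rfl, hv⟩ := aux_orth W l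
  have hvV : v ∈ V := by
    have := V.sub_mem hl (hWV hw)
    simpa using this
  have hve := hVe v hvV
  have hv0 : v = 0 := by
    refine hVnew v hvV (fun y hy => ?_) (aux_shift P hP v fun y hy => ?_)
    · have h := hv _ (hall y hy)
      have h' : ∑ i, star (eDel ε y i) * v i = v y + ε * v (-y) := by
        simp only [eDel, Pi.add_apply, Pi.smul_apply, star_add, add_mul, Finset.sum_add_distrib,
          smul_eq_mul, star_mul, hεs, Pi.single_apply]
        simp
      rw [h', hve, ← mul_assoc, hεε] at h
      linear_combination h / 2
    · have hu : IsUnit (-(b' * y)) := (hub'.mul hy).neg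
      have h := hv _ (hS _ (hall _ hu))
      have hst : ∀ k : ZMod N, star (stdAddChar k : ℂ) = stdAddChar (-k) := by
        intro k
        rw [AddChar.map_neg_eq_conj]; rfl
      have h' : ∑ i, star (dft (eDel ε (-(b' * y))) (b * i)) * v i = dft v y + ε * dft v (-y) := by
        simp only [aux_dft_eDel, star_add, star_mul, hεs, hst]
        simp only [dft_apply, smul_eq_mul,
          Finset.mul_sum, ← Finset.sum_add_distrib]
        refine Finset.sum_congr rfl fun i _ => ?_
        have e1 : -(b' * y) * (b * i) = -(i * y) := by linear_combination (-(i * y)) * hb'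
        rw [e1]
        simp only [neg_neg, mul_neg]
        ring
      rw [h', aux_dft_neg ε v hve, ← mul_assoc, hεε] at h
      linear_combination h / 2
  rw [hv0, add_zero]
  exact hw

open ZMod in
lemma aux_S {N : ℕ} [NeZero N] (p : ℕ) (hp : p ≠ 0) (P b : ZMod N) (hb : IsUnit b)
    (hPp : P * p = 0) (hPP : P * P = 0) (l : ZMod N → ℂ)
    (hl : ∀ x, x * P = 0 → ∑ t ∈ Finset.range p, l (x + P * (t : ZMod N)) = 0)
    (x : ZMod N) (hx : x * P = 0) :
    ∑ t ∈ Finset.range p, dft l (b * (x + P * (t : ZMod N))) = 0 := by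
  classical
  have hp' : (p : ℂ) ≠ 0 := Nat.cast_ne_zero.2 hp
  let g : ZMod N → ℂ := fun j => if j * P = 0 then stdAddChar (-(j * (b * x))) * l j else 0
  have h1 : ∀ j : ZMod N, ∑ t ∈ Finset.range p,
      stdAddChar (-(j * (b * (x + P * (t : ZMod N))))) * l j = p * g j := by
    intro j
    have e : ∀ t : ℕ, (stdAddChar (-(j * (b * (x + P * (t : ZMod N))))) : ℂ)
        = stdAddChar (-(j * b * P)) ^ t * stdAddChar (-(j * (b * x))) := by
      intro t
      rw [← AddChar.map_nsmul_eq_pow, ← AddChar.map_add_eq_mul, nsmul_eq_mul]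
      congr 1
      ring
    simp only [e, mul_assoc, ← Finset.sum_mul]
    by_cases hj : j * P = 0
    · have : -(j * (b * P)) = 0 := by linear_combination -b * hj
      simp [this, g, hj]
    · have hz : (stdAddChar (-(j * (b * P))) : ℂ) ≠ 1 := by
        intro h
        rw [← AddChar.map_zero_eq_one (stdAddChar (N := N))] at h
        have h' := injective_stdAddChar h
        apply hj
        rw [← hb.mul_right_eq_zero]
        linear_combination -h'
      have hpow : (stdAddChar (-(j * (b * P))) : ℂ) ^ p = 1 := by
        rw [← AddChar.map_nsmul_eq_pow, nsmul_eq_mul]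
        have : (p : ZMod N) * -(j * (b * P)) = 0 := by linear_combination (-j * b) * hPp
        rw [this, AddChar.map_zero_eq_one]
      rw [geom_sum_eq hz, hpow]
      simp [g, hj]
  have h2 : ∑ t ∈ Finset.range p, dft l (b * (x + P * (t : ZMod N))) = p * ∑ j, g j := by
    simp only [dft_apply, smul_eq_mul]
    rw [Finset.sum_comm, Finset.mul_sum]
    exact Finset.sum_congr rfl fun j _ => h1 j
  have h3 : (p : ℂ) * ∑ j, g j = ∑ t ∈ Finset.range p, ∑ j, g (j + P * (t : ZMod N)) := by
    have : ∀ t ∈ Finset.range p, ∑ j, g (j + P * (t : ZMod N)) = ∑ j, g j := by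
      intro t _
      exact Fintype.sum_equiv (Equiv.addRight (P * (t : ZMod N))) _ _ fun j => rfl
    rw [Finset.sum_congr rfl this]
    simp
  rw [h2, h3, Finset.sum_comm]
  refine Finset.sum_eq_zero fun j _ => ?_
  by_cases hj : j * P = 0
  · have : ∀ t : ℕ, g (j + P * (t : ZMod N))
        = stdAddChar (-(j * (b * x))) * l (j + P * (t : ZMod N)) := by
      intro t
      have e1 : (j + P * (t : ZMod N)) * P = 0 := by linear_combination hj + t * hPP
      have e2 : (j + P * (t : ZMod N)) * (b * x) = j * (b * x) := by
        linear_combination (t * b) * hx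
      simp only [g, e1, e2, if_true]
    simp only [this, ← Finset.mul_sum, hl j hj, mul_zero]
  · refine Finset.sum_eq_zero fun t _ => ?_
    have e1 : ¬ (j + P * (t : ZMod N)) * P = 0 := by
      intro h
      apply hj
      linear_combination h - t * hPP
    simp only [g, e1, if_false]

lemma ee_coe (r : ℚ) : ee (r : QZ) = Complex.exp (2 * Real.pi * Complex.I * (r : ℂ)) := rfl

lemma ee_add (s t : QZ) : ee (s + t) = ee s * ee t := by
  induction s using QuotientAddGroup.induction_on with | H s => ?_
  induction t using QuotientAddGroup.induction_on with | H t => ?_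
  rw [← QuotientAddGroup.mk_add]
  rw [ee_coe, ee_coe, ee_coe, ← Complex.exp_add]
  push_cast
  ring_nf

lemma ee_zero : ee 0 = 1 := by
  have := ee_coe 0
  simpa using this

lemma ee_neg (s : QZ) : ee (-s) = (ee s)⁻¹ := by
  refine eq_inv_of_mul_eq_one_left ?_
  rw [← ee_add, neg_add_cancel, ee_zero]

open ZMod in
lemma ee_Q (p α : ℕ) [NeZero (p ^ α)] (a : ℤ) (Q : ZMod (p ^ α) → QZ)
    (hQ : ∀ x : ZMod (p ^ α), Q x = (((a * (x.val : ℚ) ^ 2 / (p ^ α : ℚ)) : ℚ) : QZ))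
    (x : ZMod (p ^ α)) : ee (Q x) = stdAddChar ((a : ZMod (p ^ α)) * x ^ 2) := by
  have : (a : ZMod (p ^ α)) * x ^ 2 = ((a * (x.val : ℤ) ^ 2 : ℤ) : ZMod (p ^ α)) := by
    push_cast
    rw [ZMod.natCast_zmod_val]
  rw [this, stdAddChar_coe, hQ, ee_coe]
  push_cast
  ring_nf

open ZMod in
lemma ee_B (p α : ℕ) [NeZero (p ^ α)] (a : ℤ) (Q : ZMod (p ^ α) → QZ)
    (hQ : ∀ x : ZMod (p ^ α), Q x = (((a * (x.val : ℚ) ^ 2 / (p ^ α : ℚ)) : ℚ) : QZ))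
    (y x : ZMod (p ^ α)) : ee (-(Bf Q y x)) = stdAddChar (-(x * (2 * (a : ZMod (p ^ α)) * y))) := by
  have : -(Bf Q y x) = -Q (y + x) + Q y + Q x := by unfold Bf; abel
  rw [this, ee_add, ee_add, ee_neg, ee_Q p α a Q hQ, ee_Q p α a Q hQ, ee_Q p α a Q hQ,
    ← AddChar.map_neg_eq_inv, ← AddChar.map_add_eq_mul, ← AddChar.map_add_eq_mul]
  congr 1
  ring

lemma aux_nonunit (p : ℕ) (hp : p.Prime) (α : ℕ) (y : ZMod (p ^ α)) (hy : ¬ IsUnit y) :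
    ∃ u, y = (p : ZMod (p ^ α)) * u := by
  have : NeZero (p ^ α) := ⟨pow_ne_zero _ hp.ne_zero⟩
  rw [← ZMod.natCast_zmod_val y, ZMod.isUnit_iff_coprime] at hy
  have h : ¬ Nat.Coprime y.val p := fun h => hy (h.pow_right α)
  rw [Nat.coprime_comm, hp.coprime_iff_not_dvd, not_not] at h
  obtain ⟨u, hu⟩ := h
  refine ⟨u, ?_⟩
  rw [← ZMod.natCast_zmod_val y, hu]
  push_cast
  rfl

lemma aux_pu (p : ℕ) (hp : p.Prime) (α : ℕ) (hα : 1 ≤ α) (u : ZMod (p ^ α)) :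
    ¬ IsUnit ((p : ZMod (p ^ α)) * u) := by
  intro h
  have h1 := isUnit_of_mul_isUnit_left h
  rw [ZMod.isUnit_iff_coprime, Nat.coprime_pow_right_iff (by omega), Nat.coprime_self] at h1
  exact hp.one_lt.ne' h1

lemma aux_pP (p α : ℕ) (hα : 1 ≤ α) :
    (p : ZMod (p ^ α)) * (p : ZMod (p ^ α)) ^ (α - 1) = 0 := by
  rw [← pow_succ', Nat.sub_add_cancel hα]
  have := ZMod.natCast_self (p ^ α)
  push_cast at this
  exact this

lemma aux_mulP (p : ℕ) (hp : p.Prime) (α : ℕ) (hα : 1 ≤ α) (y : ZMod (p ^ α)) :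
    y * (p : ZMod (p ^ α)) ^ (α - 1) = 0 ↔ ∃ u, y = (p : ZMod (p ^ α)) * u := by
  constructor
  · intro h
    apply aux_nonunit p hp
    intro hu
    rw [hu.mul_right_eq_zero] at h
    have h' : ((p ^ (α - 1) : ℕ) : ZMod (p ^ α)) = 0 := by push_cast; exact h
    rw [ZMod.natCast_eq_zero_iff, Nat.pow_dvd_pow_iff_le_right hp.one_lt] at h'
    omega
  · rintro ⟨u, rfl⟩
    linear_combination u * aux_pP p α hα

lemma aux_sq (p : ℕ) (hp : p.Prime) (α : ℕ) (hα : 1 ≤ α)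
    (h2 : IsUnit (2 : ZMod (p ^ α))) (x z : ZMod (p ^ α)) (hx : IsUnit x)
    (h : z ^ 2 = x ^ 2) : z = x ∨ z = -x := by
  have h0 : (z - x) * (z + x) = 0 := by linear_combination h
  by_cases h1 : IsUnit (z - x)
  · right
    exact eq_neg_of_add_eq_zero_left (h1.mul_right_eq_zero.1 h0)
  by_cases h3 : IsUnit (z + x)
  · left
    exact sub_eq_zero.1 (h3.mul_left_eq_zero.1 h0)
  exfalso
  obtain ⟨u, hu⟩ := aux_nonunit p hp α _ h1
  obtain ⟨v, hv⟩ := aux_nonunit p hp α _ h3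
  apply aux_pu p hp α hα (v - u)
  rw [mul_sub, ← hu, ← hv]
  have : z + x - (z - x) = 2 * x := by ring
  rw [this]
  exact h2.mul hx

lemma aux_inv {N : ℕ} [NeZero N]
    (ρ : Matrix.SpecialLinearGroup (Fin 2) ℤ →* ((ZMod N → ℂ) ≃ₗ[ℂ] (ZMod N → ℂ)))
    (V : Submodule ℂ (ZMod N → ℂ))
    (hT : ∀ l ∈ V, ρ ModularGroup.T l ∈ V) (hS : ∀ l ∈ V, ρ ModularGroup.S l ∈ V)
    (A : Matrix.SpecialLinearGroup (Fin 2) ℤ) : ∀ l ∈ V, ρ A l ∈ V := by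
  have hA : A ∈ Subgroup.closure {ModularGroup.S, ModularGroup.T} := by
    rw [SpecialLinearGroup.SL2Z_generators]
    trivial
  induction hA using Subgroup.closure_induction with
  | mem g hg =>
    rcases hg with rfl | rfl
    · exact hS
    · exact hT
  | one => intro l hl; simpa using hl
  | mul g h _ _ ihg ihh =>
    intro l hl
    rw [map_mul]
    exact ihg _ (ihh _ hl)
  | inv g _ ih =>
    intro l hl
    have hle : V.map (ρ g).toLinearMap ≤ V := by
      rintro _ ⟨m, hm, rfl⟩
      exact ih m hm
    have heq := Submodule.eq_of_le_of_finrank_eq hle (LinearEquiv.finrank_map_eq (ρ g) V)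
    rw [← heq] at hl
    obtain ⟨m, hm, rfl⟩ := hl
    have : ρ g⁻¹ ((ρ g).toLinearMap m) = m := by
      have h : (ρ g⁻¹ * ρ g) m = m := by rw [← map_mul]; simp
      exact h
    rw [this]
    exact hm


/-- for `q = p^α` an odd prime power and `gcd(a,p)=1`, the eigenspaces
`W₁^{±1}` of the "new part" of the Weil representation of `L_q(a) = (ℤ/q, a x²/q)`
are nonzero, invariant and irreducible under the action `ρ` of `SL₂(ℤ)`. -/
theorem newpart_eigenspaces_irreducible (p : ℕ) (hp : p.Prime) (hodd : p ≠ 2)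
    (α : ℕ) (hα : 1 ≤ α) (a : ℤ) (ha : Int.gcd a p = 1)
    (Q : ZMod (p ^ α) → QZ)
    (hQ : ∀ x : ZMod (p ^ α), Q x = (((a * (x.val : ℚ) ^ 2 / (p ^ α : ℚ)) : ℚ) : QZ))
    (W1 : Set (ZMod (p ^ α) → ℂ))
    (hW1a : α = 1 → W1 = Set.univ)
    (hW1b : 2 ≤ α → W1 = {lam | ∀ x : ZMod (p ^ α), (∃ u, x = (p : ZMod (p ^ α)) * u) →
      ∑ t ∈ Finset.range p, lam (x + (p : ZMod (p ^ α)) ^ (α - 1) * (t : ZMod (p ^ α))) = 0})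
    (ε : ℂ) (hε : ε = 1 ∨ ε = -1)
    (W1e : Set (ZMod (p ^ α) → ℂ))
    (hW1e : W1e = {lam ∈ W1 | ∀ x, lam (-x) = ε * lam x})
    (ρ : Matrix.SpecialLinearGroup (Fin 2) ℤ →*
      ((ZMod (p ^ α) → ℂ) ≃ₗ[ℂ] (ZMod (p ^ α) → ℂ)))
    (hρT : ∀ lam, ρ ⟨!![1, 1; 0, 1], by norm_num [Matrix.det_fin_two_of]⟩ lam
      = Tweil Q lam)
    (hρS : ∀ lam, ρ ⟨!![0, -1; 1, 0], by norm_num [Matrix.det_fin_two_of]⟩ lam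
      = Sweil Q lam) :
    (∃ lam ∈ W1e, lam ≠ 0) ∧
    (∀ (A : Matrix.SpecialLinearGroup (Fin 2) ℤ), ∀ lam ∈ W1e, ρ A lam ∈ W1e) ∧
    (∀ W : Submodule ℂ (ZMod (p ^ α) → ℂ), (W : Set (ZMod (p ^ α) → ℂ)) ⊆ W1e →
      (∀ (A : Matrix.SpecialLinearGroup (Fin 2) ℤ), ∀ lam ∈ W, ρ A lam ∈ W) →
      (W : Set (ZMod (p ^ α) → ℂ)) = {0} ∨ (W : Set (ZMod (p ^ α) → ℂ)) = W1e) := by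
  classical
  have hNZ : NeZero (p ^ α) := ⟨pow_ne_zero _ hp.ne_zero⟩
  have hpodd : Odd p := hp.odd_of_ne_two hodd
  have hN : Odd (p ^ α) := hpodd.pow
  have hN1 : p ^ α ≠ 1 := (Nat.one_lt_pow (by omega) hp.one_lt).ne'
  have hF1 : Fact (1 < p ^ α) := ⟨Nat.one_lt_pow (by omega) hp.one_lt⟩
  have h2 : IsUnit (2 : ZMod (p ^ α)) := by
    have : IsUnit ((2 : ℕ) : ZMod (p ^ α)) := by
      rw [ZMod.isUnit_iff_coprime]
      exact Nat.coprime_two_left.2 hN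
    exact_mod_cast this
  have hau : IsUnit (a : ZMod (p ^ α)) := by
    have h1 : IsCoprime a ((p ^ α : ℕ) : ℤ) := by
      push_cast
      exact (Int.isCoprime_iff_gcd_eq_one.2 ha).pow_right
    obtain ⟨u, v, huv⟩ := h1
    have := congrArg (Int.cast : ℤ → ZMod (p ^ α)) huv
    push_cast at this
    have hz := ZMod.natCast_self (p ^ α)
    push_cast at hz
    rw [hz, mul_zero, add_zero] at this
    exact .of_mul_eq_one _ (by rw [mul_comm]; exact this)
  set P : ZMod (p ^ α) := (p : ZMod (p ^ α)) ^ (α - 1) with hPdef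
  have hmP := aux_mulP p hp α hα
  rw [← hPdef] at hmP
  have hmem : ∀ l, l ∈ W1 ↔ (2 ≤ α → ∀ x : ZMod (p ^ α), x * P = 0 →
      ∑ t ∈ Finset.range p, l (x + P * (t : ZMod (p ^ α))) = 0) := by
    intro l
    rcases Nat.lt_or_ge α 2 with h | h
    · rw [hW1a (by omega)]
      simp only [Set.mem_univ, true_iff]
      intro h'; omega
    · rw [hW1b h]
      simp only [Set.mem_ofPred_eq, h, true_imp_iff, hmP]
  have hmemV : ∀ l, l ∈ W1e ↔ (2 ≤ α → ∀ x : ZMod (p ^ α), x * P = 0 →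
      ∑ t ∈ Finset.range p, l (x + P * (t : ZMod (p ^ α))) = 0) ∧ ∀ x, l (-x) = ε * l x := by
    intro l
    rw [hW1e, Set.mem_sep_iff, hmem]
  let V : Submodule ℂ (ZMod (p ^ α) → ℂ) :=
    { carrier := W1e
      zero_mem' := by
        rw [hmemV]; simp
      add_mem' := by
        intro l m hl hm
        rw [hmemV] at *
        refine ⟨fun h x hx => ?_, fun x => ?_⟩
        · simp only [Pi.add_apply, Finset.sum_add_distrib, hl.1 h x hx, hm.1 h x hx, add_zero]
        · simp only [Pi.add_apply, hl.2, hm.2, mul_add]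
      smul_mem' := by
        intro c l hl
        rw [hmemV] at *
        refine ⟨fun h x hx => ?_, fun x => ?_⟩
        · simp only [Pi.smul_apply, smul_eq_mul, ← Finset.mul_sum, hl.1 h x hx, mul_zero]
        · simp only [Pi.smul_apply, smul_eq_mul, hl.2]; ring }
  have hV : ∀ l, l ∈ V ↔ l ∈ W1e := fun l => Iff.rfl
  have hT' : ∀ l, ρ ModularGroup.T l
      = fun x => ZMod.stdAddChar ((a : ZMod (p ^ α)) * x ^ 2) * l x := by
    intro l
    refine (hρT l).trans ?_
    funext x
    simp only [Tweil, ee_Q p α a Q hQ]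
  obtain ⟨c, hS'⟩ : ∃ c : ℂ, ∀ l, ρ ModularGroup.S l
      = c • fun y => ZMod.dft l (2 * (a : ZMod (p ^ α)) * y) := by
    refine ⟨gaussSigma Q * ((Real.sqrt (Nat.card (ZMod (p ^ α))) : ℂ))⁻¹, fun l => ?_⟩
    refine (hρS l).trans ?_
    funext y
    simp only [Sweil, ee_B p α a Q hQ, Pi.smul_apply, smul_eq_mul, ZMod.dft_apply,
      finsum_eq_sum_of_fintype]
  have hc : c ≠ 0 := by
    rintro rfl
    have h := hS' (fun _ => 1)
    rw [zero_smul] at h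
    have h' := (LinearEquiv.map_eq_zero_iff _).1 h
    have := congrFun h' 0
    simp at this
  have hb : IsUnit (2 * (a : ZMod (p ^ α))) := h2.mul hau
  refine ⟨⟨eDel ε 1, ?_, ?_⟩, ?_, ?_⟩
  · rw [hmemV]
    have hz : ∀ x : ZMod (p ^ α), ¬ IsUnit x → eDel ε 1 x = 0 := by
      intro x hx
      have e1 : x ≠ 1 := by rintro rfl; exact hx isUnit_one
      have e2 : x ≠ -1 := by rintro rfl; exact hx isUnit_one.neg
      simp [eDel, e1, e2]
    refine ⟨fun h x hx => Finset.sum_eq_zero fun t _ => hz _ ?_, fun x => ?_⟩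
    · have hPP : P * P = 0 := by
        rw [hmP]
        refine ⟨(p : ZMod (p ^ α)) ^ (α - 2), ?_⟩
        rw [← pow_succ', hPdef]
        congr 1
        omega
      have : (x + P * (t : ZMod (p ^ α))) * P = 0 := by linear_combination hx + t * hPP
      obtain ⟨u, hu⟩ := (hmP _).1 this
      rw [hu]
      exact aux_pu p hp α hα u
    · have hεε : ε * ε = 1 := by rcases hε with rfl | rfl <;> norm_num
      simp only [eDel, Pi.add_apply, Pi.smul_apply, smul_eq_mul, Pi.single_apply,
        neg_eq_iff_eq_neg, neg_neg, mul_add, ← mul_assoc, hεε, one_mul]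
      ring
  · intro h
    have h1 := congrFun h 1
    have e : (1 : ZMod (p ^ α)) ≠ -1 := by
      intro h
      apply h2.ne_zero
      linear_combination h
    simp [eDel, e] at h1
  · intro A l hl
    refine aux_inv ρ V (fun l hl => ?_) (fun l hl => ?_) A l hl
    · rw [hV, hmemV] at *
      rw [hT']
      refine ⟨fun h x hx => ?_, fun x => ?_⟩
      · have hPP : P * P = 0 := by
          rw [hmP]
          refine ⟨(p : ZMod (p ^ α)) ^ (α - 2), ?_⟩
          rw [← pow_succ', hPdef]
          congr 1
          omega
        have e : ∀ t : ℕ, (a : ZMod (p ^ α)) * (x + P * (t : ZMod (p ^ α))) ^ 2 = a * x ^ 2 := by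
          intro t
          linear_combination (2 * a * t) * hx + a * t ^ 2 * hPP
        simp only [e, ← Finset.mul_sum, hl.1 h x hx, mul_zero]
      · simp only [neg_sq, hl.2]
        ring
    · rw [hS']
      refine V.smul_mem c ?_
      rw [hV, hmemV] at *
      refine ⟨fun h x hx => ?_, fun x => ?_⟩
      · have hPP : P * P = 0 := by
          rw [hmP]
          refine ⟨(p : ZMod (p ^ α)) ^ (α - 2), ?_⟩
          rw [← pow_succ', hPdef]
          congr 1
          omega
        have hPp : P * p = 0 := by rw [mul_comm]; exact aux_pP p α hα
        exact aux_S p hp.ne_zero P _ hb hPp hPP l (hl.1 h) x hx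
      · rw [mul_neg]
        exact aux_dft_neg ε l hl.2 _
  · intro W hWV hW
    have key := aux_irred hN hN1 h2 (a : ZMod (p ^ α)) (2 * (a : ZMod (p ^ α))) hau hb ε hε
      (aux_sq p hp α hα h2) P (fun y hy => (hmP y).2 (aux_nonunit p hp α y hy)) V W hWV
      (fun l hl => ((hmemV l).1 hl).2) ?_ ?_ ?_
    · rcases key with h | h
      · left; rw [h]; rfl
      · right; rw [h]; rfl
    · intro l hl hlu hlP
      have hl' := ((hmemV l).1 hl).1
      funext x
      rcases Nat.lt_or_ge α 2 with h | h
      · have hP1 : P = 1 := by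
          rw [hPdef]
          have : α - 1 = 0 := by omega
          rw [this, pow_zero]
        have := hlP 1 (x - 1)
        rw [hP1, one_mul, add_sub_cancel, hlu 1 isUnit_one] at this
        exact this
      · by_cases hx : IsUnit x
        · exact hlu x hx
        · have := hl' h x ((hmP x).2 (aux_nonunit p hp α x hx))
          simpa [hlP, hp.ne_zero] using this
    · intro l hl
      rw [← hT']
      exact hW _ l hl
    · intro l hl
      have := hW ModularGroup.S l hl
      rw [hS'] at this
      exact (W.smul_mem_iff hc).1 this
end

section
/- Let q = p^α be a prime power. Two row vectors v = (x,y) and w = (x',y') in (ℤ/q)² lie in the same orbit under the right-multiplication action of SL₂(ℤ/q) (v·A for A ∈ SL₂(ℤ/q)) if and only if the ideals of ℤ/q generated by {x,y} and by {x',y'} coincide. Consequently the orbits are exactly the sets O_d = {(x,y) : gcd(x,y,q) = d} for the divisors d of q, and the number of orbits equals the number of divisors of q. -/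
namespace OrbAux

/-- gcd of the entries with the modulus -/
def gg (N : ℕ) (v : Fin 2 → ZMod N) : ℕ := Nat.gcd (Nat.gcd (v 0).val (v 1).val) N

/-- the orbit relation -/
def rel (N : ℕ) (v w : Fin 2 → ZMod N) : Prop :=
  ∃ A : Matrix.SpecialLinearGroup (Fin 2) (ZMod N),
    Matrix.vecMul v (A : Matrix (Fin 2) (Fin 2) (ZMod N)) = w

lemma rel_symm {N : ℕ} {v w : Fin 2 → ZMod N} (h : rel N v w) : rel N w v := by
  obtain ⟨A, rfl⟩ := h
  refine ⟨A⁻¹, ?_⟩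
  rw [Matrix.vecMul_vecMul, ← Matrix.SpecialLinearGroup.coe_mul, mul_inv_cancel]
  simp

lemma rel_trans {N : ℕ} {u v w : Fin 2 → ZMod N} (h : rel N u v) (h' : rel N v w) :
    rel N u w := by
  obtain ⟨A, rfl⟩ := h
  obtain ⟨B, rfl⟩ := h'
  exact ⟨A * B, by rw [Matrix.vecMul_vecMul, ← Matrix.SpecialLinearGroup.coe_mul]⟩

lemma rel_span_le {N : ℕ} {v w : Fin 2 → ZMod N} (h : rel N v w) :
    Ideal.span {w 0, w 1} ≤ Ideal.span {v 0, v 1} := by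
  obtain ⟨A, rfl⟩ := h
  rw [Ideal.span_le]
  have key : ∀ j, Matrix.vecMul v (A : Matrix (Fin 2) (Fin 2) (ZMod N)) j ∈
      Ideal.span {v 0, v 1} := by
    intro j
    rw [Ideal.mem_span_pair]
    refine ⟨A.1 0 j, A.1 1 j, ?_⟩
    simp [Matrix.vecMul, dotProduct, Fin.sum_univ_two, mul_comm]
  rintro x (rfl | rfl)
  · exact key 0
  · exact key 1

lemma dvd_of_mem {N : ℕ} [NeZero N] {w : Fin 2 → ZMod N} {x : ZMod N}
    (h : x ∈ Ideal.span {w 0, w 1}) : gg N w ∣ x.val := by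
  rw [Ideal.mem_span_pair] at h
  obtain ⟨a, b, rfl⟩ := h
  have hN : gg N w ∣ N := Nat.gcd_dvd_right _ _
  have h0 : gg N w ∣ (w 0).val := (Nat.gcd_dvd_left _ _).trans (Nat.gcd_dvd_left _ _)
  have h1 : gg N w ∣ (w 1).val := (Nat.gcd_dvd_left _ _).trans (Nat.gcd_dvd_right _ _)
  rw [ZMod.val_add, ZMod.val_mul, ZMod.val_mul]
  refine (Nat.dvd_mod_iff hN).2 (dvd_add ?_ ?_)
  · exact (Nat.dvd_mod_iff hN).2 (h0.mul_left _)
  · exact (Nat.dvd_mod_iff hN).2 (h1.mul_left _)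

lemma gg_dvd {N : ℕ} [NeZero N] {v w : Fin 2 → ZMod N}
    (h : Ideal.span {v 0, v 1} ≤ Ideal.span {w 0, w 1}) : gg N w ∣ gg N v := by
  refine Nat.dvd_gcd (Nat.dvd_gcd ?_ ?_) (Nat.gcd_dvd_right _ _)
  · exact dvd_of_mem (h (Ideal.subset_span (by simp)))
  · exact dvd_of_mem (h (Ideal.subset_span (by simp)))

lemma rel_normal (p : ℕ) (hp : p.Prime) (α : ℕ) (v : Fin 2 → ZMod (p ^ α)) :
    rel (p ^ α) ![(gg (p ^ α) v : ZMod (p ^ α)), 0] v := by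
  haveI : NeZero (p ^ α) := ⟨pow_ne_zero _ hp.ne_zero⟩
  have hN : gg (p ^ α) v ∣ p ^ α := Nat.gcd_dvd_right _ _
  obtain ⟨x, hx⟩ : gg (p ^ α) v ∣ (v 0).val :=
    (Nat.gcd_dvd_left _ _).trans (Nat.gcd_dvd_left _ _)
  obtain ⟨y, hy⟩ : gg (p ^ α) v ∣ (v 1).val :=
    (Nat.gcd_dvd_left _ _).trans (Nat.gcd_dvd_right _ _)
  have hx' : v 0 = (gg (p ^ α) v : ZMod (p ^ α)) * x := by
    rw [← Nat.cast_mul, ← hx, ZMod.natCast_zmod_val]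
  have hy' : v 1 = (gg (p ^ α) v : ZMod (p ^ α)) * y := by
    rw [← Nat.cast_mul, ← hy, ZMod.natCast_zmod_val]
  have hd : gg (p ^ α) v ≠ 0 := fun h => this.out (Nat.eq_zero_of_zero_dvd (h ▸ hN))
  obtain ⟨m, hm⟩ := hN
  by_cases hpm : p ∣ m
  · have hxy : ¬ p ∣ x ∨ ¬ p ∣ y := by
      by_contra! hc
      have h1 : gg (p ^ α) v * p ∣ gg (p ^ α) v := by
        conv_rhs => unfold gg
        refine Nat.dvd_gcd (Nat.dvd_gcd ?_ ?_) ?_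
        · rw [hx]; exact mul_dvd_mul_left _ hc.1
        · rw [hy]; exact mul_dvd_mul_left _ hc.2
        · conv_rhs => rw [hm]
          exact mul_dvd_mul_left _ hpm
      have h2 := Nat.le_of_dvd (Nat.pos_of_ne_zero hd) h1
      have h3 := hp.two_le
      have h4 := Nat.pos_of_ne_zero hd
      nlinarith
    have hu : ∀ z : ℕ, ¬ p ∣ z → ∃ t : ZMod (p ^ α), (z : ZMod (p ^ α)) * t = 1 := by
      intro z hz
      have : IsUnit (z : ZMod (p ^ α)) :=
        (ZMod.isUnit_iff_coprime _ _).2 (((hp.coprime_iff_not_dvd).2 hz).symm.pow_right α)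
      exact this.exists_right_inv
    rcases hxy with h | h
    · obtain ⟨t, ht⟩ := hu _ h
      refine ⟨⟨!![(x : ZMod (p ^ α)), y; 0, t], by simp [Matrix.det_fin_two, ht]⟩, ?_⟩
      ext i
      fin_cases i
      · simp [Matrix.vecMul, dotProduct, Fin.sum_univ_two, hx']
      · simp [Matrix.vecMul, dotProduct, Fin.sum_univ_two, hy']
    · obtain ⟨t, ht⟩ := hu _ h
      refine ⟨⟨!![(x : ZMod (p ^ α)), y; -t, 0], by simp [Matrix.det_fin_two, ht]⟩, ?_⟩
      ext i
      fin_cases i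
      · simp [Matrix.vecMul, dotProduct, Fin.sum_univ_two, hx']
      · simp [Matrix.vecMul, dotProduct, Fin.sum_univ_two, hy']
  · have hm1 : m = 1 := by
      have : m ∣ p ^ α := ⟨gg (p ^ α) v, by rw [mul_comm]; exact hm⟩
      obtain ⟨k, -, rfl⟩ := (Nat.dvd_prime_pow hp).1 this
      rcases k with _ | k
      · simp
      · exact absurd (dvd_pow_self p (Nat.succ_ne_zero k)) hpm
    have h0 : (gg (p ^ α) v : ZMod (p ^ α)) = 0 := by
      rw [ZMod.natCast_eq_zero_iff]
      exact ⟨1, by rw [mul_one]; rw [hm1, mul_one] at hm; exact hm.symm⟩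
    rw [h0, zero_mul] at hx' hy'
    refine ⟨1, ?_⟩
    rw [h0]
    ext i
    fin_cases i
    · simp [hx']
    · simp [hy']

lemma rel_iff_span (p : ℕ) (hp : p.Prime) (α : ℕ) (v w : Fin 2 → ZMod (p ^ α)) :
    (rel (p ^ α) v w ↔ Ideal.span {v 0, v 1} = Ideal.span {w 0, w 1}) ∧
    (rel (p ^ α) v w ↔ gg (p ^ α) v = gg (p ^ α) w) := by
  haveI : NeZero (p ^ α) := ⟨pow_ne_zero _ hp.ne_zero⟩
  have h1 : rel (p ^ α) v w → Ideal.span {v 0, v 1} = Ideal.span {w 0, w 1} :=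
    fun h => le_antisymm (rel_span_le (rel_symm h)) (rel_span_le h)
  have h2 : Ideal.span {v 0, v 1} = Ideal.span {w 0, w 1} → gg (p ^ α) v = gg (p ^ α) w :=
    fun h => Nat.dvd_antisymm (gg_dvd h.ge) (gg_dvd h.le)
  have h3 : gg (p ^ α) v = gg (p ^ α) w → rel (p ^ α) v w := by
    intro h
    have a := rel_normal p hp α v
    rw [h] at a
    exact rel_trans (rel_symm a) (rel_normal p hp α w)
  exact ⟨⟨h1, h3 ∘ h2⟩, ⟨h2 ∘ h1, h3⟩⟩

lemma card_quot (p : ℕ) (hp : p.Prime) (α : ℕ) :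
    Nat.card (Quot (rel (p ^ α))) = (p ^ α).divisors.card := by
  haveI : NeZero (p ^ α) := ⟨pow_ne_zero _ hp.ne_zero⟩
  rw [← Nat.card_eq_finsetCard]
  let f : Quot (rel (p ^ α)) → (p ^ α).divisors :=
    Quot.lift (fun v => ⟨gg (p ^ α) v, Nat.mem_divisors.2 ⟨Nat.gcd_dvd_right _ _, this.out⟩⟩)
      (fun v w h => Subtype.ext ((rel_iff_span p hp α v w).2.1 h))
  refine Nat.card_eq_of_bijective f ⟨?_, ?_⟩
  · rintro ⟨v⟩ ⟨w⟩ h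
    exact Quot.sound ((rel_iff_span p hp α v w).2.2 (congrArg Subtype.val h))
  · rintro ⟨d, hd⟩
    refine ⟨Quot.mk _ ![(d : ZMod (p ^ α)), 0], Subtype.ext ?_⟩
    have hdN := (Nat.mem_divisors.1 hd).1
    change gg _ _ = d
    simp only [gg, Matrix.cons_val_zero, Matrix.cons_val_one, ZMod.val_zero, Nat.gcd_zero_right,
      ZMod.val_natCast]
    rw [(Nat.mod_modEq d (p ^ α)).gcd_eq]
    exact Nat.gcd_eq_left hdN

end OrbAux

/-- two row vectors of `(ℤ/q)²`, `q = p^α`, are in the same orbit under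
right multiplication by `SL₂(ℤ/q)` iff they generate the same ideal of `ℤ/q`, iff
the gcds of their lifts with `q` agree; consequently the number of orbits is the
number of divisors of `q`. -/
theorem SL2_row_vector_orbits (p : ℕ) (hp : p.Prime) (α : ℕ) :
    (∀ v w : Fin 2 → ZMod (p ^ α),
      ((∃ A : Matrix.SpecialLinearGroup (Fin 2) (ZMod (p ^ α)),
          Matrix.vecMul v (A : Matrix (Fin 2) (Fin 2) (ZMod (p ^ α))) = w) ↔
        Ideal.span {v 0, v 1} = Ideal.span {w 0, w 1})) ∧
    (∀ v w : Fin 2 → ZMod (p ^ α),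
      ((∃ A : Matrix.SpecialLinearGroup (Fin 2) (ZMod (p ^ α)),
          Matrix.vecMul v (A : Matrix (Fin 2) (Fin 2) (ZMod (p ^ α))) = w) ↔
        Nat.gcd (Nat.gcd (v 0).val (v 1).val) (p ^ α)
          = Nat.gcd (Nat.gcd (w 0).val (w 1).val) (p ^ α))) ∧
    Nat.card (Quot fun v w : Fin 2 → ZMod (p ^ α) =>
        ∃ A : Matrix.SpecialLinearGroup (Fin 2) (ZMod (p ^ α)),
          Matrix.vecMul v (A : Matrix (Fin 2) (Fin 2) (ZMod (p ^ α))) = w)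
      = (p ^ α).divisors.card := by
  exact ⟨fun v w => (OrbAux.rel_iff_span p hp α v w).1,
    fun v w => (OrbAux.rel_iff_span p hp α v w).2, OrbAux.card_quot p hp α⟩
end

section
/- Let K = ℚ(√−3) and let O be its ring of integers, the Eisenstein integers ℤ[(−1+√−3)/2]. Let N ≥ 1 be an integer and let I ⊆ O be an additive subgroup of index N which contains 2√−3·N·O and such that N divides the norm Nm_{K/ℚ}(α) for every α ∈ I. Then I is a principal O-ideal generated by an element of norm N: there exists ρ ∈ O with Nm_{K/ℚ}(ρ) = N and I = ρ·O. -/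
noncomputable section

/-- `ω = (-1+√-3)/2`, a primitive cube root of unity in `ℂ`. -/
def eisOmega : ℂ := ⟨-1 / 2, Real.sqrt 3 / 2⟩

/-- The ring of Eisenstein integers `ℤ[ω] = ℤ[(-1+√-3)/2]`, the ring of integers of
`ℚ(√-3)`, realized as a subring of `ℂ`. -/
def Eis : Subring ℂ := Subring.closure {eisOmega}

/-- `ω` as an element of the Eisenstein integers. -/
def eisOmega' : Eis := ⟨eisOmega, Subring.subset_closure (Set.mem_singleton _)⟩

end

theorem eis_form_one : ∀ (n : ℕ) (A B C : ℤ), A.natAbs ≤ n → 0 < A → B ^ 2 - 4 * A * C = -3 →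
    ∃ x y : ℤ, A * x ^ 2 + B * x * y + C * y ^ 2 = 1 := by
  intro n
  induction n with
  | zero => intro A B C h1 h2; omega
  | succ n ih =>
    intro A B C h1 h2 h3
    by_cases hA : A = 1
    · exact ⟨1, 0, by subst hA; ring⟩
    -- choose k with |B + 2 A k| ≤ A
    obtain ⟨k, hk1, hk2⟩ : ∃ k : ℤ, -A ≤ B + 2 * A * k ∧ B + 2 * A * k ≤ A := by
      refine ⟨-((B + A) / (2 * A)), ?_, ?_⟩
      · have := Int.mul_ediv_self_le (x := B + A) (k := 2 * A) (by omega)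
        linarith
      · have := Int.lt_mul_ediv_self_add (x := B + A) (k := 2 * A) (by omega)
        linarith
    set B' := B + 2 * A * k with hB'
    set C' := A * k ^ 2 + B * k + C with hC'
    have h4 : B' ^ 2 - 4 * A * C' = -3 := by rw [hB', hC']; linear_combination h3
    have h5 : B' ^ 2 ≤ A ^ 2 := by nlinarith
    have hC0 : 0 < C' := by
      by_contra hc
      push Not at hc
      nlinarith [sq_nonneg B']
    have hCA : C' < A := by
      by_contra hc
      push Not at hc
      have : 2 ≤ A := by omega
      nlinarith
    obtain ⟨x, y, hxy⟩ := ih C' (-B') A (by omega) hC0 (by linear_combination h4)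
    refine ⟨-y + k * x, x, ?_⟩
    rw [← hxy, hB', hC']; ring

theorem eis_lattice_basis (N : ℕ) (hN : 1 ≤ N) (H : AddSubgroup (Fin 2 → ℤ)) (hidx : H.index = N) :
    ∃ α β : Fin 2 → ℤ, α ∈ H ∧ β ∈ H ∧ (∀ v ∈ H, ∃ x y : ℤ, v = x • α + y • β) ∧
      (α 0 * β 1 - α 1 * β 0) ^ 2 = (N : ℤ) ^ 2 := by
  obtain ⟨e⟩ := Int.addSubgroup_index_ne_zero_iff.1 (show H.index ≠ 0 by omega)
  let b : Module.Basis (Fin 2) ℤ H := Module.Basis.ofEquivFun e.toIntLinearEquiv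
  refine ⟨b 0, b 1, (b 0).2, (b 1).2, ?_, ?_⟩
  · intro v hv
    refine ⟨b.repr ⟨v, hv⟩ 0, b.repr ⟨v, hv⟩ 1, ?_⟩
    have := congrArg (Subtype.val) (b.sum_repr ⟨v, hv⟩)
    rw [Fin.sum_univ_two] at this
    exact this.symm
  · have h := AddSubgroup.index_eq_natAbs_det (Pi.basisFun ℤ (Fin 2)) H b
    rw [hidx, Pi.basisFun_det_apply, Matrix.det_fin_two] at h
    rw [h, Int.natCast_natAbs, sq_abs]
    simp only [Matrix.of_apply]

theorem eis_lattice (N : ℕ) (hN : 1 ≤ N) (H : AddSubgroup (Fin 2 → ℤ)) (hidx : H.index = N)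
    (hn : ∀ v ∈ H, (N : ℤ) ∣ v 0 ^ 2 - v 0 * v 1 + v 1 ^ 2) :
    ∃ p q : ℤ, p ^ 2 - p * q + q ^ 2 = N ∧
      ∀ v : Fin 2 → ℤ, v ∈ H ↔ ∃ U V : ℤ, v = ![U * p - V * q, U * q + V * p - V * q] := by
  obtain ⟨α, β, hα, hβ, hsp, hdet⟩ := eis_lattice_basis N hN H hidx
  have hN0 : (N : ℤ) ≠ 0 := by omega
  have hNpos : (0 : ℤ) < N := by omega
  have htr : ∀ v ∈ H, ∀ w ∈ H,
      (N : ℤ) ∣ 2 * v 0 * w 0 - v 0 * w 1 - v 1 * w 0 + 2 * v 1 * w 1 := by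
    intro v hv w hw
    have h := dvd_sub (dvd_sub (hn _ (H.add_mem hv hw)) (hn v hv)) (hn w hw)
    simp only [Pi.add_apply] at h
    have e : 2 * v 0 * w 0 - v 0 * w 1 - v 1 * w 0 + 2 * v 1 * w 1 =
        (v 0 + w 0) ^ 2 - (v 0 + w 0) * (v 1 + w 1) + (v 1 + w 1) ^ 2 -
          (v 0 ^ 2 - v 0 * v 1 + v 1 ^ 2) - (w 0 ^ 2 - w 0 * w 1 + w 1 ^ 2) := by ring
    rw [e]
    exact h
  obtain ⟨A, hA⟩ := hn α hα
  obtain ⟨C, hC⟩ := hn β hβ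
  obtain ⟨B, hB⟩ := htr α hα β hβ
  have hdisc : B ^ 2 - 4 * A * C = -3 := by
    have h : (N : ℤ) ^ 2 * (B ^ 2 - 4 * A * C) = (N : ℤ) ^ 2 * (-3) := by
      calc (N : ℤ) ^ 2 * (B ^ 2 - 4 * A * C) = (N * B) ^ 2 - 4 * (N * A) * (N * C) := by ring
        _ = -3 * (α 0 * β 1 - α 1 * β 0) ^ 2 := by rw [← hA, ← hB, ← hC]; ring
        _ = _ := by rw [hdet]; ring
    exact mul_left_cancel₀ (pow_ne_zero 2 hN0) h
  have hA0 : 0 < A := by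
    have h1 : 0 ≤ (N : ℤ) * A := by
      rw [← hA]; nlinarith [sq_nonneg (α 0 - α 1), sq_nonneg (α 0), sq_nonneg (α 1)]
    have h2 : 0 ≤ A := nonneg_of_mul_nonneg_right h1 hNpos
    rcases h2.lt_or_eq with h | h
    · exact h
    · subst h; nlinarith [sq_nonneg B]
  obtain ⟨x, y, hxy⟩ := eis_form_one _ A B C le_rfl hA0 hdisc
  have hρ : x • α + y • β ∈ H := H.add_mem (H.zsmul_mem hα x) (H.zsmul_mem hβ y)
  obtain ⟨p, hp⟩ : ∃ p, p = x * α 0 + y * β 0 := ⟨_, rfl⟩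
  obtain ⟨q, hq⟩ : ∃ q, q = x * α 1 + y * β 1 := ⟨_, rfl⟩
  have hρ' : x • α + y • β = ![p, q] := by
    ext i; fin_cases i <;> simp [hp, hq]
  rw [hρ'] at hρ
  have hpq : p ^ 2 - p * q + q ^ 2 = N := by
    rw [hp, hq]
    linear_combination x ^ 2 * hA + x * y * hB + y ^ 2 * hC + N * hxy
  -- the quotient
  have key : ∀ v ∈ H, ∀ V : ℤ, p * v 1 - q * v 0 = N * V →
      ∃ U : ℤ, v = ![U * p - V * q, U * q + V * p - V * q] := by
    intro v hv V hV
    obtain ⟨T, hT⟩ := htr _ hρ v hv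
    obtain ⟨M, hM⟩ := hn v hv
    simp only [Matrix.cons_val_zero, Matrix.cons_val_one] at hT
    have h4 : T ^ 2 + 3 * V ^ 2 = 4 * M := by
      have h : (N : ℤ) ^ 2 * (T ^ 2 + 3 * V ^ 2) = (N : ℤ) ^ 2 * (4 * M) := by
        calc (N : ℤ) ^ 2 * (T ^ 2 + 3 * V ^ 2) = (N * T) ^ 2 + 3 * (N * V) ^ 2 := by ring
          _ = 4 * (p ^ 2 - p * q + q ^ 2) * (v 0 ^ 2 - v 0 * v 1 + v 1 ^ 2) := by
            rw [← hT, ← hV]; ring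
          _ = _ := by rw [hpq, hM]; ring
      exact mul_left_cancel₀ (pow_ne_zero 2 hN0) h
    have hpar : ∃ U, T + V = 2 * U := by
      have h6 : Even (T ^ 2 + 3 * V ^ 2) := by rw [h4]; exact ⟨2 * M, by ring⟩
      have h5 : Even (T + V) := by
        simp only [Int.even_add, Int.even_mul, Int.even_pow] at h6 ⊢
        have h3 : ¬ Even (3 : ℤ) := by decide
        tauto
      obtain ⟨U, hU⟩ := h5
      exact ⟨U, by omega⟩
    obtain ⟨U, hU⟩ := hpar
    have hu : v 0 * p - v 0 * q + v 1 * q = N * U := by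
      have : 2 * (v 0 * p - v 0 * q + v 1 * q) = 2 * (N * U) := by
        linear_combination hT + hV + N * hU
      omega
    refine ⟨U, ?_⟩
    have e0 : v 0 = U * p - V * q := by
      apply mul_left_cancel₀ hN0
      linear_combination (-v 0) * hpq + p * hu - q * hV
    have e1 : v 1 = U * q + V * p - V * q := by
      apply mul_left_cancel₀ hN0
      linear_combination (-v 1) * hpq + q * hu + (p - q) * hV
    ext i; fin_cases i
    · simpa using e0
    · simpa using e1
  obtain ⟨ε, hε, hεN⟩ : ∃ ε : ℤ, ε ^ 2 = 1 ∧ α 0 * β 1 - α 1 * β 0 = N * ε := by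
    rcases sq_eq_sq_iff_eq_or_eq_neg.1 hdet with h | h
    · exact ⟨1, by norm_num, by rw [h]; ring⟩
    · exact ⟨-1, by norm_num, by rw [h]; ring⟩
  -- ω ρ ∈ H
  have hω : ![-q, p - q] ∈ H := by
    have hσ : (-(C * y)) • α + (A * x + B * y) • β ∈ H :=
      H.add_mem (H.zsmul_mem hα _) (H.zsmul_mem hβ _)
    obtain ⟨U, hU⟩ := key _ hσ ε (by
      simp only [Pi.add_apply, Pi.smul_apply, smul_eq_mul]
      rw [hp, hq]
      linear_combination hεN + (α 0 * β 1 - α 1 * β 0) * hxy)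
    rw [hU] at hσ
    have := H.zsmul_mem (H.sub_mem hσ (H.zsmul_mem hρ U)) ε
    convert this using 1
    ext i; fin_cases i
    · simp; linear_combination (-q) * hε
    · simp; linear_combination (q - p) * hε
  refine ⟨p, q, hpq, fun v => ⟨fun hv => ?_, ?_⟩⟩
  · obtain ⟨z, w, rfl⟩ := hsp v hv
    obtain ⟨U, hU⟩ := key _ hv (ε * (x * w - y * z)) (by
      simp only [Pi.add_apply, Pi.smul_apply, smul_eq_mul]
      rw [hp, hq]
      linear_combination (x * w - y * z) * hεN)
    exact ⟨U, _, hU⟩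
  · rintro ⟨U, V, rfl⟩
    have := H.add_mem (H.zsmul_mem hρ U) (H.zsmul_mem hω V)
    convert this using 1
    ext i; fin_cases i
    · simp; ring
    · simp; ring

theorem eisOmega_sq : eisOmega ^ 2 = -1 - eisOmega := by
  have h : Real.sqrt 3 * Real.sqrt 3 = 3 := Real.mul_self_sqrt (by norm_num)
  apply Complex.ext
  · simp [eisOmega, pow_two]; linear_combination (-1 / 4) * h
  · simp [eisOmega, pow_two]; ring

theorem eisOmega'_sq : eisOmega' ^ 2 = -1 - eisOmega' :=
  Subtype.ext (by simpa [eisOmega'] using eisOmega_sq)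

theorem eis_normSq (a b : ℤ) : Complex.normSq ((a : ℂ) + b * eisOmega) =
    ((a ^ 2 - a * b + b ^ 2 : ℤ) : ℝ) := by
  have h : Real.sqrt 3 * Real.sqrt 3 = 3 := Real.mul_self_sqrt (by norm_num)
  simp [Complex.normSq_apply, eisOmega]
  linear_combination (b : ℝ) ^ 2 / 4 * h

theorem eis_exists (x : Eis) : ∃ a b : ℤ, x = (a : Eis) + b * eisOmega' := by
  obtain ⟨x, hx⟩ := x
  suffices h : ∃ a b : ℤ, x = (a : ℂ) + b * eisOmega by
    obtain ⟨a, b, h⟩ := h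
    exact ⟨a, b, Subtype.ext (by simpa [eisOmega'] using h)⟩
  induction hx using Subring.closure_induction with
  | mem x hx => exact ⟨0, 1, by simpa using hx⟩
  | zero => exact ⟨0, 0, by simp⟩
  | one => exact ⟨1, 0, by simp⟩
  | add x y _ _ hx hy =>
    obtain ⟨a, b, rfl⟩ := hx
    obtain ⟨c, d, rfl⟩ := hy
    exact ⟨a + c, b + d, by push_cast; ring⟩
  | neg x _ hx =>
    obtain ⟨a, b, rfl⟩ := hx
    exact ⟨-a, -b, by push_cast; ring⟩
  | mul x y _ _ hx hy =>
    obtain ⟨a, b, rfl⟩ := hx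
    obtain ⟨c, d, rfl⟩ := hy
    refine ⟨a * c - b * d, a * d + b * c - b * d, ?_⟩
    push_cast
    linear_combination (b : ℂ) * d * eisOmega_sq

/-- an additive subgroup `I` of the Eisenstein integers `O` of index `N`
which contains `2√-3·N·O` (note `√-3 = 2ω+1`) and all of whose elements have norm
(`Nm(α) = |α|²`) divisible by `N` is a principal ideal generated by an element of
norm `N`. -/
theorem eisenstein_subgroup_is_principal (N : ℕ) (hN : 1 ≤ N) (I : AddSubgroup Eis)
    (hidx : I.index = N)
    (hcont : ∀ x : Eis, 2 * (N : Eis) * (2 * eisOmega' + 1) * x ∈ I)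
    (hnorm : ∀ α : Eis, α ∈ I → ∃ m : ℤ, Complex.normSq (α : ℂ) = (N : ℝ) * (m : ℝ)) :
    ∃ ρ : Eis, Complex.normSq (ρ : ℂ) = (N : ℝ) ∧
      (I : Set Eis) = {x : Eis | ∃ c : Eis, x = c * ρ} := by
  let φ : (Fin 2 → ℤ) →+ Eis :=
    { toFun := fun v => (v 0 : Eis) + (v 1 : Eis) * eisOmega'
      map_zero' := by simp
      map_add' := by intro v w; simp; ring }
  have hφ : ∀ v, φ v = (v 0 : Eis) + (v 1 : Eis) * eisOmega' := fun _ => rfl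
  have hφs : Function.Surjective φ := by
    intro x
    obtain ⟨a, b, rfl⟩ := eis_exists x
    exact ⟨![a, b], by simp [hφ]⟩
  have hφn : ∀ v, Complex.normSq (φ v : ℂ) = ((v 0 ^ 2 - v 0 * v 1 + v 1 ^ 2 : ℤ) : ℝ) := by
    intro v
    rw [← eis_normSq, hφ]
    simp [eisOmega']
  obtain ⟨p, q, hpq, hH⟩ := eis_lattice N hN (I.comap φ)
    (by rw [AddSubgroup.index_comap_of_surjective _ hφs, hidx]) (by
      intro v hv
      obtain ⟨m, hm⟩ := hnorm (φ v) hv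
      rw [hφn] at hm
      exact ⟨m, by exact_mod_cast hm⟩)
  have hmul : ∀ U V : ℤ, φ ![U * p - V * q, U * q + V * p - V * q] =
      ((U : Eis) + V * eisOmega') * φ ![p, q] := by
    intro U V
    simp only [hφ, Matrix.cons_val_zero, Matrix.cons_val_one]
    push_cast
    linear_combination (-(V : Eis) * q) * eisOmega'_sq
  refine ⟨φ ![p, q], ?_, ?_⟩
  · rw [hφn]
    simp only [Matrix.cons_val_zero, Matrix.cons_val_one]
    rw [hpq]; simp
  · ext x
    simp only [SetLike.mem_coe, Set.mem_ofPred_eq]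
    constructor
    · intro hx
      obtain ⟨v, rfl⟩ := hφs x
      obtain ⟨U, V, rfl⟩ := (hH v).1 hx
      exact ⟨_, hmul U V⟩
    · rintro ⟨c, rfl⟩
      obtain ⟨U, V, rfl⟩ := eis_exists c
      rw [← hmul]
      exact (hH _).2 ⟨U, V, rfl⟩
end
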